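/- Let k ≥ 2 be a fixed integer. There exists a constant C > 0, depending only on k, such that for every odd prime power q, the hypergraph Y_{f,q} associated with the polynomial f(x_1,…,x_k) = x_1 x_2 ⋯ x_k + 1 satisfies |N*_{Y_{f,q}}(𝒪_k^e) − q^{2k}/2| ≤ C·q^{2k−1}. -/

import Mathlib

open MvPolynomial

/-- The number of labeled induced even partial octahedrons in the hypergraph `Y_{f,q}`:
the number of injective maps `u : [k] × {0,1} → F_q` such that the number of `ε ∈ {0,1}^k`
with `f(u(1,ε_1),…,u(k,ε_k))` not a square in `F_q` is even. -/
noncomputable def NEPO {F : Type*} [Field F] [Fintype F] {k : ℕ}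
    (f : MvPolynomial (Fin k) F) : ℕ :=
  Set.ncard {u : Fin k × Bool → F | Function.Injective u ∧
    Even (Set.ncard {ε : Fin k → Bool |
      ¬ IsSquare (MvPolynomial.eval (fun i => u (i, ε i)) f)})}

namespace Polynomial

lemma hd_dvd {F : Type} [Field F] (f : F[X]) (n : ℕ) : ∀ a, f ^ (n - a) ∣ hasseDeriv a (f ^ n) := by
  induction n with
  | zero => intro a; simp
  | succ n ih =>
    intro a
    rw [pow_succ f n, hasseDeriv_mul]
    apply Finset.dvd_sum
    rintro ⟨c, d⟩ hcd
    rw [Finset.HasAntidiagonal.mem_antidiagonal] at hcd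
    simp only at hcd ⊢
    rcases Nat.eq_zero_or_pos d with rfl | hd
    · have h1 : f ^ (n + 1 - a) ∣ f ^ (n - c) * f := by
        rw [← pow_succ]; apply pow_dvd_pow; omega
      refine h1.trans ?_
      rw [hasseDeriv_zero']
      exact mul_dvd_mul (ih c) dvd_rfl
    · have h1 : f ^ (n + 1 - a) ∣ f ^ (n - c) := by
        apply pow_dvd_pow; omega
      exact (h1.trans (ih c)).trans (Dvd.intro _ rfl)

lemma hd_E {F : Type} [Field F] (f : F[X]) (hf : f ≠ 0) (m : ℕ) (hm : f.natDegree ≤ m) (n : ℕ) :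
    ∃ E : ℕ → F[X], ∀ a ≤ n, hasseDeriv a (f ^ n) = f ^ (n - a) * E a ∧ (E a).natDegree ≤ a * m := by
  choose E hE using hd_dvd f n
  refine ⟨E, fun a ha => ⟨hE a, ?_⟩⟩
  by_cases h0 : E a = 0
  · simp [h0]
  have h1 := natDegree_hasseDeriv_le (f ^ n) a
  rw [hE a, natDegree_mul (pow_ne_zero _ hf) h0, natDegree_pow, natDegree_pow] at h1
  have h2 : n * f.natDegree = (n - a) * f.natDegree + a * f.natDegree := by
    rw [← add_mul]; congr 1; omega
  have h3 : a * f.natDegree ≤ a * m := Nat.mul_le_mul_left _ hm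
  omega

/-- reduced derivative -/
noncomputable def redD {F : Type} [Field F] (f : F[X]) (E : ℕ → F[X]) (i : ℕ) : F[X] →ₗ[F] F[X] :=
  ∑ p ∈ Finset.HasAntidiagonal.antidiagonal i, (LinearMap.mulLeft F (f ^ p.2 * E p.1)) ∘ₗ hasseDeriv p.2

lemma redD_spec {F : Type} [Field F] (f : F[X]) (E : ℕ → F[X]) (n : ℕ)
    (hE : ∀ a ≤ n, hasseDeriv a (f ^ n) = f ^ (n - a) * E a) (i : ℕ) (hi : i ≤ n) (h : F[X]) :
    hasseDeriv i (f ^ n * h) = f ^ (n - i) * redD f E i h := by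
  rw [hasseDeriv_mul, redD]
  simp only [LinearMap.sum_apply, LinearMap.comp_apply, LinearMap.mulLeft_apply]
  rw [Finset.mul_sum]
  apply Finset.sum_congr rfl
  rintro ⟨a, b⟩ hab
  rw [Finset.HasAntidiagonal.mem_antidiagonal] at hab
  simp only at hab ⊢
  rw [hE a (by omega), show n - a = (n - i) + b by omega, pow_add]
  ring

lemma redD_deg {F : Type} [Field F] (f : F[X]) (E : ℕ → F[X]) (m n : ℕ) (hm : f.natDegree ≤ m)
    (hE : ∀ a ≤ n, (E a).natDegree ≤ a * m) (i : ℕ) (hi : i ≤ n) (h : F[X]) :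
    (redD f E i h).natDegree ≤ h.natDegree + i * m := by
  rw [redD]
  simp only [LinearMap.sum_apply, LinearMap.comp_apply, LinearMap.mulLeft_apply]
  apply natDegree_sum_le_of_forall_le
  rintro ⟨a, b⟩ hab
  rw [Finset.HasAntidiagonal.mem_antidiagonal] at hab
  simp only at hab ⊢
  have h1 := natDegree_hasseDeriv_le h b
  have h2 := hE a (by omega)
  have h3 : (f ^ b).natDegree ≤ b * m := natDegree_pow_le_of_le b hm
  have h4 : i * m = a * m + b * m := by rw [← hab, add_mul]
  refine natDegree_mul_le.trans ?_
  have := natDegree_mul_le (p := f ^ b) (q := E a)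
  omega

lemma nonvan0 {F : Type} [Field F] [Fintype F] (f g : F[X]) (b : F)
    (hf : f = (X - C b) * g) (hg : g.eval b ≠ 0) (h0 : f.eval 0 ≠ 0) (m c D : ℕ)
    (hq : Fintype.card F = 2 * c + 1) (hm : f.natDegree ≤ m) (hD : 2 * D + m ≤ 2 * c + 1)
    (r s : F[X]) (hr : r.degree < D) (hs : s.degree < D)
    (h : X ^ (Fintype.card F) ∣ r + s * f ^ c) : r = 0 ∧ s = 0 := by
  have hg0 : g ≠ 0 := by rintro rfl; simp at hg
  have hf0 : f ≠ 0 := by rintro rfl; simp at h0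
  have h1 : X ^ (Fintype.card F) ∣ f * r ^ 2 - s ^ 2 * f ^ (Fintype.card F) := by
    have : f * r ^ 2 - s ^ 2 * f ^ (Fintype.card F) = (r + s * f ^ c) * ((r - s * f ^ c) * f) := by
      rw [hq, pow_succ f (2*c), pow_mul']; ring
    rw [this]; exact h.mul_right _
  have h2 : X ^ (Fintype.card F) ∣ f ^ (Fintype.card F) - C (f.eval 0) := by
    rw [← FiniteField.expand_card f]
    have : f - C (f.eval 0) = X * f.divX := by
      conv_lhs => rw [← X_mul_divX_add f]
      rw [coeff_zero_eq_eval_zero]; simp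
    have h3 := congrArg (expand F (Fintype.card F)) this
    rw [map_sub, map_mul, expand_C, expand_X] at h3
    rw [h3]; exact Dvd.intro _ rfl
  have h3 : X ^ (Fintype.card F) ∣ f * r ^ 2 - C (f.eval 0) * s ^ 2 := by
    have := dvd_add h1 (h2.mul_left (s ^ 2))
    convert this using 1; ring
  have h4 : f * r ^ 2 - C (f.eval 0) * s ^ 2 = 0 := by
    rcases Nat.eq_zero_or_pos D with rfl | hDpos
    · have hr' : r = 0 := by simpa using hr
      have hs' : s = 0 := by simpa using hs
      simp [hr', hs']
    apply eq_zero_of_dvd_of_natDegree_lt h3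
    rw [natDegree_X_pow]
    have hr' : r.natDegree < D := by
      by_cases hr0 : r = 0
      · simp [hr0, hDpos]
      · exact (natDegree_lt_iff_degree_lt hr0).2 hr
    have hs' : s.natDegree < D := by
      by_cases hr0 : s = 0
      · simp [hr0, hDpos]
      · exact (natDegree_lt_iff_degree_lt hr0).2 hs
    refine (natDegree_sub_le _ _).trans_lt ?_
    have e1 := natDegree_mul_le (p := f) (q := r ^ 2)
    have e2 := natDegree_mul_le (p := C (f.eval 0)) (q := s ^ 2)
    rw [natDegree_pow] at e1 e2
    rw [natDegree_C] at e2
    apply max_lt <;> omega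
  have h5 : r = 0 := by
    classical
    by_contra hr0
    have hs0 : s ≠ 0 := by
      rintro rfl
      simp [hf0, hr0] at h4
    have h6 := congrArg (rootMultiplicity b) (sub_eq_zero.1 h4)
    have hC : C (f.eval 0) ≠ 0 := by simpa using h0
    rw [rootMultiplicity_mul (mul_ne_zero hf0 (pow_ne_zero _ hr0)),
      rootMultiplicity_mul (mul_ne_zero hC (pow_ne_zero _ hs0)), hf,
      rootMultiplicity_mul (hf ▸ hf0), rootMultiplicity_X_sub_C_self, rootMultiplicity_C,
      rootMultiplicity_eq_zero hg, ← count_roots, ← count_roots, roots_pow, roots_pow,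
      Multiset.count_nsmul, Multiset.count_nsmul] at h6
    omega
  refine ⟨h5, ?_⟩
  subst h5
  simpa [h0] using h4

lemma nonvan {F : Type} [Field F] [Fintype F] (f g : F[X]) (b : F)
    (hf : f = (X - C b) * g) (hg : g.eval b ≠ 0) (h0 : f.eval 0 ≠ 0) (m c D : ℕ)
    (hq : Fintype.card F = 2 * c + 1) (hm : f.natDegree ≤ m) (hD : 2 * D + m ≤ 2 * c + 1)
    (J : ℕ) : ∀ (r s : Fin J → F[X]) (_ : ∀ j, (r j).degree < D) (_ : ∀ j, (s j).degree < D)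
    (_ : ∑ j : Fin J, X ^ (Fintype.card F * (j : ℕ)) * (r j + s j * f ^ c) = 0), ∀ j, r j = 0 ∧ s j = 0 := by
  induction J with
  | zero => intro r s _ _ _ j; exact j.elim0
  | succ J ih =>
    intro r s hr hs h
    rw [Fin.sum_univ_succ] at h
    have e : ∑ j : Fin J, X ^ (Fintype.card F * ((j.succ : Fin (J+1)) : ℕ)) * (r j.succ + s j.succ * f ^ c)
       = X ^ Fintype.card F * ∑ j : Fin J, X ^ (Fintype.card F * (j : ℕ)) * (r j.succ + s j.succ * f ^ c) := by
      rw [Finset.mul_sum]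
      apply Finset.sum_congr rfl
      intro j _
      rw [Fin.val_succ, Nat.mul_add, Nat.mul_one, pow_add]; ring
    rw [e] at h
    simp only [Fin.val_zero, mul_zero, pow_zero, one_mul] at h
    have hz : r 0 = 0 ∧ s 0 = 0 := by
      apply nonvan0 f g b hf hg h0 m c D hq hm hD _ _ (hr 0) (hs 0)
      rw [eq_neg_of_add_eq_zero_left h]
      exact (Dvd.intro _ rfl : X ^ Fintype.card F ∣ _).neg_right
    rw [hz.1, hz.2] at h
    simp only [zero_mul, zero_add] at h
    have h' := (mul_eq_zero.1 h).resolve_left (pow_ne_zero _ X_ne_zero)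
    have := ih (fun j => r j.succ) (fun j => s j.succ) (fun j => hr _) (fun j => hs _) h'
    intro j
    refine Fin.cases hz this j


lemma vanish {F : Type} [Field F] [Fintype F] (f : F[X]) (c l J : ℕ) (hl : l ≤ Fintype.card F)
    (E1 E2 : ℕ → F[X])
    (hE1 : ∀ a ≤ l, hasseDeriv a (f ^ l) = f ^ (l - a) * E1 a)
    (hE2 : ∀ a ≤ l + c, hasseDeriv a (f ^ (l + c)) = f ^ (l + c - a) * E2 a)
    (α : F) (r s : Fin J → F[X])
    (h : ∀ i < l, ∑ j : Fin J, X ^ (j : ℕ) * (redD f E1 i (r j) + C α * redD f E2 i (s j)) = 0)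
    (a : F) (ha : f.eval a ^ c = α) :
    (X - C a) ^ l ∣ f ^ l * ∑ j : Fin J, X ^ (Fintype.card F * (j : ℕ)) * (r j + s j * f ^ c) := by
  set P := f ^ l * ∑ j : Fin J, X ^ (Fintype.card F * (j : ℕ)) * (r j + s j * f ^ c) with hP
  have hP2 : P = ∑ j : Fin J, X ^ (Fintype.card F * (j : ℕ)) * (f ^ l * r j + f ^ (l + c) * s j) := by
    rw [hP, Finset.mul_sum]
    apply Finset.sum_congr rfl
    intro j _
    rw [pow_add]; ring
  set Q := ∑ j : Fin J, C (a ^ (j : ℕ)) * (f ^ l * r j + f ^ (l + c) * s j) with hQ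
  have key : X ^ l ∣ taylor a P - taylor a Q := by
    rw [← map_sub, hP2, hQ, ← Finset.sum_sub_distrib, map_sum]
    apply Finset.dvd_sum
    intro j _
    rw [← sub_mul, taylor_mul]
    apply Dvd.dvd.mul_right
    have : taylor a (X ^ (Fintype.card F * (j : ℕ)) - C (a ^ (j : ℕ)))
        = (X ^ Fintype.card F + C a) ^ (j : ℕ) - (C a) ^ (j : ℕ) := by
      rw [map_sub, taylor_X_pow, taylor_C, pow_mul, ← FiniteField.expand_card (X + C a), map_add,
        expand_X, expand_C, C_pow]
    rw [this]
    refine (pow_dvd_pow X hl).trans ?_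
    have h2 := sub_dvd_pow_sub_pow (X ^ Fintype.card F + C a) (C a) (j : ℕ)
    rwa [add_sub_cancel_right] at h2
  have key2 : X ^ l ∣ taylor a Q := by
    rw [X_pow_dvd_iff]
    intro i hi
    rw [taylor_coeff, hQ, map_sum, eval_finsetSum]
    have h1 := congrArg (eval a) (h i hi)
    rw [eval_finsetSum, eval_zero] at h1
    have h2 : ∀ j : Fin J, eval a (hasseDeriv i (C (a ^ (j : ℕ)) * (f ^ l * r j + f ^ (l + c) * s j)))
       = (f.eval a) ^ (l - i) * eval a (X ^ (j : ℕ) * (redD f E1 i (r j) + C α * redD f E2 i (s j))) := by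
      intro j
      rw [← smul_eq_C_mul, map_smul, map_add, redD_spec f E1 l hE1 i hi.le,
        redD_spec f E2 (l + c) hE2 i (by omega), show l + c - i = (l - i) + c by omega, pow_add]
      simp only [eval_smul, eval_add, eval_mul, eval_pow, eval_X, eval_C, smul_eq_mul, ha]
      ring
    rw [Finset.sum_congr rfl (fun j _ => h2 j), ← Finset.mul_sum, h1, mul_zero]
  have key3 : X ^ l ∣ taylor a P := by
    have := dvd_add key key2
    rwa [sub_add_cancel] at this
  obtain ⟨R, hR⟩ := key3
  refine ⟨taylor (-a) R, ?_⟩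
  have := congrArg (taylor (-a)) hR
  rw [taylor_taylor, neg_add_cancel, taylor_zero, taylor_mul (r := -a) (X ^ l) R, taylor_X_pow] at this
  rw [this, C_neg, sub_eq_add_neg]

lemma stepanov {F : Type} [Field F] [Fintype F] [DecidableEq F] (f g : F[X]) (b : F)
    (hf : f = (X - C b) * g) (hg : g.eval b ≠ 0) (h0 : f.eval 0 ≠ 0) (m c D l J : ℕ)
    (hq : Fintype.card F = 2 * c + 1) (hm : f.natDegree ≤ m) (hD : 2 * D + m ≤ 2 * c + 1)
    (hl : l ≤ Fintype.card F) (hdim : l * (D + J + l * m) < 2 * (J * D)) (α : F) :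
    l * (Finset.univ.filter (fun a : F => f.eval a ^ c = α)).card ≤
      l * m + J * Fintype.card F + D + m * c := by
  have hf0 : f ≠ 0 := by rintro rfl; simp at h0
  obtain ⟨E1, hE1⟩ := hd_E f hf0 m hm l
  obtain ⟨E2, hE2⟩ := hd_E f hf0 m hm (l + c)
  let V := (Fin J → degreeLT F D) × (Fin J → degreeLT F D)
  let Φ : ℕ → V →ₗ[F] F[X] := fun i =>
    ∑ j : Fin J, (LinearMap.mulLeft F (X ^ (j : ℕ))) ∘ₗ
      ((redD f E1 i) ∘ₗ (degreeLT F D).subtype ∘ₗ (LinearMap.proj j) ∘ₗ LinearMap.fst F _ _ +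
       (LinearMap.mulLeft F (C α)) ∘ₗ
        (redD f E2 i) ∘ₗ (degreeLT F D).subtype ∘ₗ (LinearMap.proj j) ∘ₗ LinearMap.snd F _ _)
  have hΦ : ∀ i (v : V), Φ i v = ∑ j : Fin J, X ^ (j : ℕ) *
      (redD f E1 i (v.1 j) + C α * redD f E2 i (v.2 j)) := by
    intro i v
    simp only [Φ, LinearMap.sum_apply, LinearMap.comp_apply, LinearMap.add_apply, LinearMap.mulLeft_apply]
    rfl
  let M := D + J + l * m
  let Ψ : V →ₗ[F] (Fin l → Fin M → F) :=
    LinearMap.pi (fun i => LinearMap.pi (fun k => (lcoeff F (k : ℕ)) ∘ₗ Φ (i : ℕ)))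
  have hfin : Module.finrank F (degreeLT F D) = D := by
    rw [(degreeLTEquiv F D).finrank_eq]; simp
  have : Module.Finite F (degreeLT F D) := Module.Finite.equiv (degreeLTEquiv F D).symm
  have hker : LinearMap.ker Ψ ≠ ⊥ := by
    apply LinearMap.ker_ne_bot_of_finrank_lt
    simp only [V, Module.finrank_prod, Module.finrank_pi_fintype, hfin, Module.finrank_self]
    simp only [Finset.sum_const, Finset.card_univ, Fintype.card_fin, smul_eq_mul, mul_one]
    simp only [M]; omega
  obtain ⟨v, hv, hv0⟩ := Submodule.exists_mem_ne_zero_of_ne_bot hker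
  have hdeg : ∀ p : degreeLT F D, (p : F[X]).degree < D := fun p => mem_degreeLT.1 p.2
  have hnd : ∀ p : degreeLT F D, (p : F[X]).natDegree ≤ D := fun p =>
    natDegree_le_of_degree_le (hdeg p).le
  have hJ : 0 < D := by
    rcases Nat.eq_zero_or_pos D with h | h
    · subst h; simp at hdim
    · exact h
  have hnd' : ∀ p : degreeLT F D, (p : F[X]).natDegree < D := fun p => by
    by_cases hp : (p : F[X]) = 0
    · simp [hp, hJ]
    · exact (natDegree_lt_iff_degree_lt hp).2 (hdeg p)
  have hz : ∀ i < l, ∑ j : Fin J, X ^ (j : ℕ) *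
      (redD f E1 i (v.1 j) + C α * redD f E2 i (v.2 j)) = 0 := by
    intro i hi
    rw [← hΦ]
    ext k
    rw [coeff_zero]
    by_cases hk : k < M
    · have := congrFun (congrFun (LinearMap.mem_ker.1 hv) ⟨i, hi⟩) ⟨k, hk⟩
      simpa [Ψ] using this
    · apply coeff_eq_zero_of_natDegree_lt
      refine lt_of_le_of_lt ?_ (lt_of_lt_of_le (Nat.sub_lt (n := M) (m := 1) (by simp only [M]; omega) one_pos) (not_lt.1 hk))
      rw [hΦ]
      apply natDegree_sum_le_of_forall_le
      intro j _
      refine natDegree_mul_le.trans ?_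
      rw [natDegree_X_pow]
      have him : i * m ≤ l * m := Nat.mul_le_mul_right _ hi.le
      have d1 := redD_deg f E1 m l hm (fun a ha => (hE1 a ha).2) i hi.le (v.1 j)
      have d2 := redD_deg f E2 m (l + c) hm (fun a ha => (hE2 a ha).2) i (by omega) (v.2 j)
      have d3 := natDegree_C_mul_le α (redD f E2 i (v.2 j))
      have d4 := natDegree_add_le (redD f E1 i (v.1 j)) (C α * redD f E2 i (v.2 j))
      have d5 := hnd' (v.1 j)
      have d6 := hnd' (v.2 j)
      have d7 : (redD f E1 i (v.1 j) + C α * redD f E2 i (v.2 j)).natDegree ≤ D - 1 + l * m := by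
        refine d4.trans (max_le ?_ ?_) <;> omega
      have := j.2
      simp only [M]
      omega
  set P := f ^ l * ∑ j : Fin J, X ^ (Fintype.card F * (j : ℕ)) *
    ((v.1 j : F[X]) + (v.2 j : F[X]) * f ^ c) with hP
  have hP0 : P ≠ 0 := by
    intro h
    have h' := (mul_eq_zero.1 h).resolve_left (pow_ne_zero _ hf0)
    have := nonvan f g b hf hg h0 m c D hq hm hD J (fun j => v.1 j) (fun j => v.2 j)
      (fun j => hdeg _) (fun j => hdeg _) h'
    apply hv0
    ext j
    · simpa using congrArg (fun p => coeff p _) (this j).1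
    · simpa using congrArg (fun p => coeff p _) (this j).2
  have hvan : ∀ a : F, f.eval a ^ c = α → (X - C a) ^ l ∣ P := fun a ha =>
    vanish f c l J hl E1 E2 (fun a ha => (hE1 a ha).1) (fun a ha => (hE2 a ha).1) α
      (fun j => v.1 j) (fun j => v.2 j) hz a ha
  have hPd : P.natDegree ≤ l * m + J * Fintype.card F + D + m * c := by
    rw [hP]
    refine natDegree_mul_le.trans ?_
    have e1 : (f ^ l).natDegree ≤ l * m := natDegree_pow_le_of_le l hm
    have e2 : (f ^ c).natDegree ≤ c * m := natDegree_pow_le_of_le c hm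
    have e3 : (∑ j : Fin J, X ^ (Fintype.card F * (j : ℕ)) *
        ((v.1 j : F[X]) + (v.2 j : F[X]) * f ^ c)).natDegree ≤ J * Fintype.card F + D + m * c := by
      apply natDegree_sum_le_of_forall_le
      intro j _
      refine natDegree_mul_le.trans ?_
      rw [natDegree_X_pow]
      have d1 : Fintype.card F * (j : ℕ) ≤ J * Fintype.card F := by
        rw [mul_comm]; exact Nat.mul_le_mul_right _ j.2.le
      have d2 := natDegree_add_le (v.1 j : F[X]) ((v.2 j : F[X]) * f ^ c)
      have d3 := natDegree_mul_le (p := (v.2 j : F[X])) (q := f ^ c)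
      have d5 := hnd (v.1 j)
      have d6 := hnd (v.2 j)
      have d7 : ((v.1 j : F[X]) + (v.2 j : F[X]) * f ^ c).natDegree ≤ D + m * c := by
        rw [mul_comm c m] at e2
        refine d2.trans (max_le ?_ ?_) <;> omega
      omega
    omega
  refine le_trans ?_ hPd
  set S := Finset.univ.filter (fun a : F => f.eval a ^ c = α) with hS
  have hprod : ∏ a ∈ S, (X - C a) ^ l ∣ P := by
    apply Finset.prod_dvd_of_coprime
    · intro x _ y _ hxy
      exact (isCoprime_X_sub_C_of_isUnit_sub (sub_ne_zero.2 hxy).isUnit).pow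
    · intro a ha
      exact hvan a (by simpa [hS] using ha)
  have := natDegree_le_of_dvd hprod hP0
  rw [natDegree_prod _ _ (fun a _ => pow_ne_zero _ (X_sub_C_ne_zero a))] at this
  simpa [mul_comm] using this


lemma chi_pt {F : Type} [Field F] [Fintype F] [DecidableEq F] (c : ℕ)
    (hq : Fintype.card F = 2 * c + 1) (x : F) :
    (quadraticChar F x = (if x ^ c = 1 then 1 else 0) - (if x ^ c = -1 then 1 else 0)) ∧
    ((1 : ℤ) = (if x ^ c = 1 then 1 else 0) + (if x ^ c = -1 then 1 else 0) +
      (if x = 0 then 1 else 0)) := by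
  have hF : ringChar F ≠ 2 := by
    intro h
    have := FiniteField.even_card_iff_char_two.1 h
    omega
  have h1 : (1 : F) ≠ -1 := (Ring.neg_one_ne_one_of_char_ne_two hF).symm
  have hc : c ≠ 0 := by
    rintro rfl
    have := Fintype.one_lt_card (α := F)
    omega
  have hp := quadraticChar_eq_pow_of_char_ne_two' hF x
  rw [show Fintype.card F / 2 = c by omega] at hp
  by_cases hx : x = 0
  · subst hx
    simp [hc]
  · rcases quadraticChar_dichotomy hx with h | h
    · rw [h] at hp ⊢
      rw [← hp]; simp [h1, hx]
    · rw [h] at hp ⊢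
      rw [← hp]; simp [h1.symm, hx]

lemma weil (m : ℕ) : ∃ B : ℕ, ∀ (F : Type) [Field F] [Fintype F] [DecidableEq F] (f g : F[X]) (b : F)
    (_ : f = (X - C b) * g) (_ : g.eval b ≠ 0) (_ : f.eval 0 ≠ 0) (_ : f.natDegree ≤ m)
    (_ : Odd (Fintype.card F)),
    (∑ a, quadraticChar F (f.eval a)) ^ 2 ≤ (B : ℤ) * Fintype.card F := by
  refine ⟨4 * (m + 3) ^ 2 + 16 * (8 * m + 4) ^ 2, ?_⟩
  intro F _ _ _ f g b hf hg h0 hm hodd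
  have hf0 : f ≠ 0 := by rintro rfl; simp at h0
  obtain ⟨c, hq⟩ := hodd
  set N1 := (Finset.univ.filter (fun a : F => f.eval a ^ c = 1)).card with hN1
  set N2 := (Finset.univ.filter (fun a : F => f.eval a ^ c = -1)).card with hN2
  set Z := (Finset.univ.filter (fun a : F => f.eval a = 0)).card with hZ
  have hE : (∑ a, quadraticChar F (f.eval a)) = (N1 : ℤ) - N2 := by
    rw [Finset.sum_congr rfl (fun a _ => (chi_pt c hq (f.eval a)).1), Finset.sum_sub_distrib]
    simp [hN1, hN2]
  have hsum : (Fintype.card F : ℤ) = N1 + N2 + Z := by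
    have : (Fintype.card F : ℤ) = ∑ a : F, (1 : ℤ) := by simp
    rw [this, Finset.sum_congr rfl (fun a _ => (chi_pt c hq (f.eval a)).2), Finset.sum_add_distrib,
      Finset.sum_add_distrib]
    simp [hN1, hN2, hZ]
  have hZm : Z ≤ m := by
    refine le_trans ?_ hm
    apply Polynomial.card_le_degree_of_subset_roots
    intro a ha
    simp only [Finset.mem_val, Finset.mem_filter] at ha
    exact (mem_roots hf0).2 ha.2
  rw [hE]
  set q := Fintype.card F with hqd
  have hE2 : |(N1 : ℤ) - N2| ≤ q := by
    rw [abs_le]; constructor <;> linarith [Int.natCast_nonneg N1, Int.natCast_nonneg N2, Int.natCast_nonneg Z]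
  obtain ⟨e, he1, he2⟩ : ∃ e : ℕ, 4 * e ^ 2 ≤ q ∧ q < 4 * (e + 1) ^ 2 := by
    refine ⟨Nat.sqrt (q / 4), ?_, ?_⟩
    · have := Nat.sqrt_le' (q / 4)
      omega
    · have := Nat.lt_succ_sqrt' (q / 4)
      rw [Nat.succ_eq_add_one] at this
      omega
  have hq0 : (0 : ℤ) < q := by rw [hq]; positivity
  by_cases hem : m + 2 ≤ e
  · have hN : ∀ α : F, 2 * e * (Finset.univ.filter (fun a : F => f.eval a ^ c = α)).card ≤
        2 * e * m + (e + (4 * m + 3)) * q + (c - m) + m * c := by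
      intro α
      have hee : 2 * e ≤ e ^ 2 := by nlinarith
      have hme : m ≤ e ^ 2 := by nlinarith
      have hD : e ^ 2 ≤ c - m := by omega
      have hmc : m ≤ c := by omega
      apply stepanov f g b hf hg h0 m c (c - m) (2 * e) (e + (4 * m + 3)) hq hm (by omega)
        (by rw [← hqd]; omega)
      generalize c - m = D at hD
      have a1 : (4 * m + 3) * e ^ 2 ≤ (4 * m + 3) * D := Nat.mul_le_mul_left _ hD
      have a2 : (4 * m + 3) * (2 * e) ≤ (4 * m + 3) * e ^ 2 := Nat.mul_le_mul_left _ hee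
      have a3 : 0 < e ^ 2 := by omega
      nlinarith
    have hb : ∀ N : ℕ, 2 * e * N ≤ 2 * e * m + (e + (4 * m + 3)) * q + (c - m) + m * c →
        (e : ℤ) * (2 * N - q + m) ≤ (8 * m + 4) * q := by
      intro N hN
      have e1 : c - m ≤ q := by omega
      have e2 : m * c ≤ m * q := Nat.mul_le_mul_left _ (by omega)
      have e3 : e ≤ q := by nlinarith
      have e4 : e * m ≤ q * m := Nat.mul_le_mul_right _ e3
      have : 2 * e * N ≤ 2 * e * m + (e + (4 * m + 3)) * q + q + m * q := by omega
      zify at this e4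
      nlinarith
    have b1 := hb N1 (hN 1)
    have b2 := hb N2 (hN (-1))
    have b3 : |(e : ℤ) * ((N1 : ℤ) - N2)| ≤ (8 * m + 4) * q := by
      have hZm' : (Z : ℤ) ≤ m := by exact_mod_cast hZm
      have he0 : (0 : ℤ) ≤ e := Int.natCast_nonneg e
      rw [abs_le]
      constructor
      · have : (e : ℤ) * (N2 - N1) ≤ e * (2 * N2 - q + m) := by
          apply mul_le_mul_of_nonneg_left _ he0; linarith
        linarith
      · have : (e : ℤ) * (N1 - N2) ≤ e * (2 * N1 - q + m) := by
          apply mul_le_mul_of_nonneg_left _ he0; linarith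
        linarith
    have b4 := sq_le_sq' (abs_le.1 b3).1 (abs_le.1 b3).2
    have b5 : (q : ℤ) ≤ 16 * (e : ℤ) ^ 2 := by
      have : q ≤ 16 * e ^ 2 := by nlinarith
      exact_mod_cast this
    have b6 : (q : ℤ) * ((N1 : ℤ) - N2) ^ 2 ≤ q * (16 * (8 * m + 4) ^ 2 * q) := by
      calc (q : ℤ) * ((N1 : ℤ) - N2) ^ 2 ≤ 16 * (e : ℤ) ^ 2 * ((N1 : ℤ) - N2) ^ 2 :=
            mul_le_mul_of_nonneg_right b5 (sq_nonneg _)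
        _ = 16 * ((e : ℤ) * ((N1 : ℤ) - N2)) ^ 2 := by ring
        _ ≤ 16 * ((8 * m + 4) * q) ^ 2 := by linarith
        _ = _ := by ring
    have b7 := le_of_mul_le_mul_left b6 hq0
    push_cast
    nlinarith [sq_nonneg ((m : ℤ) + 3)]
  · have b4 := sq_le_sq' (abs_le.1 hE2).1 (abs_le.1 hE2).2
    have b5 : q ≤ 4 * (m + 3) ^ 2 := by
      have : e + 1 ≤ m + 3 := by omega
      have := Nat.pow_le_pow_left this 2
      omega
    have b6 : (q : ℤ) ≤ 4 * ((m : ℤ) + 3) ^ 2 := by exact_mod_cast b5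
    have b8 : (q : ℤ) * q ≤ 4 * ((m : ℤ) + 3) ^ 2 * q := mul_le_mul_of_nonneg_right b6 hq0.le
    have b9 : 0 ≤ 16 * (8 * (m : ℤ) + 4) ^ 2 * q := by positivity
    push_cast
    rw [add_mul]
    rw [sq (q : ℤ)] at b4
    linarith

/-- The key square-root cancellation for products of linear forms. -/
lemma weil_prod (ι : Type) [Fintype ι] [DecidableEq ι] : ∃ B : ℕ, ∀ (F : Type) [Field F] [Fintype F] [DecidableEq F] (A : ι → F) (i₀ : ι)
    (_ : A i₀ ≠ 0) (_ : ∀ i ≠ i₀, A i ≠ A i₀)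
    (_ : Odd (Fintype.card F)),
    (∑ x, ∏ i, quadraticChar F (x * A i + 1)) ^ 2 ≤ (B : ℤ) * Fintype.card F := by
  obtain ⟨B, hB⟩ := weil (Fintype.card ι)
  refine ⟨B, fun F _ _ _ A i₀ hA hne hodd => ?_⟩
  set f : F[X] := ∏ i, (X * C (A i) + 1) with hf
  have hev : ∀ x, f.eval x = ∏ i, (x * A i + 1) := by
    intro x; simp only [hf, eval_prod, eval_add, eval_mul, eval_X, eval_C, eval_one]
  have := hB F f (C (A i₀) * ∏ i ∈ Finset.univ.erase i₀, (X * C (A i) + 1)) (-(A i₀)⁻¹) ?_ ?_ ?_ ?_ hodd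
  · simpa [hev, map_prod] using this
  · rw [hf, ← Finset.mul_prod_erase _ _ (Finset.mem_univ i₀), ← mul_assoc]
    congr 1
    rw [C_neg, sub_neg_eq_add, add_mul, ← C_mul, inv_mul_cancel₀ hA, C_1]
  · simp only [eval_mul, eval_C, eval_prod, eval_add, eval_X, eval_one]
    refine mul_ne_zero hA (Finset.prod_ne_zero_iff.2 ?_)
    intro i hi h
    apply hne i (Finset.ne_of_mem_erase hi)
    field_simp at h
    linear_combination -h
  · rw [hev]; simp
  · refine (natDegree_prod_le _ _).trans ?_
    calc _ ≤ ∑ i : ι, 1 := by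
          apply Finset.sum_le_sum
          intro i _
          compute_degree
      _ = _ := by simp


lemma cnt_bd {ι F : Type} [Fintype ι] [DecidableEq ι] [Fintype F] (S : Finset (ι → F)) (p : ι)
    (h : ∀ u ∈ S, ∀ v ∈ S, (∀ i, i ≠ p → u i = v i) → u p = v p) :
    S.card ≤ Fintype.card F ^ (Fintype.card ι - 1) := by
  classical
  have h1 : S.card ≤ (Finset.univ : Finset ({i // i ≠ p} → F)).card := by
    apply Finset.card_le_card_of_injOn (fun u i => u i.1) (fun _ _ => Finset.mem_coe.2 (Finset.mem_univ _))
    intro u hu v hv huv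
    have h2 : ∀ i, i ≠ p → u i = v i := fun i hi => congrFun huv ⟨i, hi⟩
    funext i
    by_cases hi : i = p
    · rw [hi]; exact h u hu v hv h2
    · exact h2 i hi
  refine h1.trans (le_of_eq ?_)
  rw [Finset.card_univ, Fintype.card_fun]
  congr 1
  rw [Fintype.card_subtype_compl, Fintype.card_subtype_eq]

/-- Product determined by a coordinate. -/
lemma prod_det {κ F : Type} [Fintype κ] [DecidableEq κ] [Field F] (u v : κ × Bool → F)
    (ε : κ → Bool) (i₀ : κ) (hne : ∏ i, u (i, ε i) ≠ 0)
    (h : ∏ i, u (i, ε i) = ∏ i, v (i, ε i))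
    (huv : ∀ p, p ≠ (i₀, ε i₀) → u p = v p) : u (i₀, ε i₀) = v (i₀, ε i₀) := by
  rw [← Finset.mul_prod_erase _ _ (Finset.mem_univ i₀)] at h hne
  rw [← Finset.mul_prod_erase _ (fun i => v (i, ε i)) (Finset.mem_univ i₀)] at h
  have e : ∏ i ∈ Finset.univ.erase i₀, u (i, ε i) = ∏ i ∈ Finset.univ.erase i₀, v (i, ε i) := by
    apply Finset.prod_congr rfl
    intro i hi
    apply huv
    intro hh
    exact Finset.ne_of_mem_erase hi (Prod.ext_iff.1 hh).1
  rw [← e] at h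
  exact mul_right_cancel₀ (right_ne_zero_of_mul hne) h

lemma bad_bd (n : ℕ) (F : Type) [Field F] [Fintype F] [DecidableEq F] :
    (Finset.univ.filter (fun u : Fin n × Bool → F => ¬ (∏ i, u (i, false) ≠ 0 ∧
      ∀ ε : Fin n → Bool, ε ≠ (fun _ => false) → ∏ i, u (i, ε i) ≠ ∏ i, u (i, false)))).card ≤
    (2 * n + 2 ^ n) * Fintype.card F ^ (2 * n - 1) := by
  classical
  set S1 : Fin n × Bool → Finset (Fin n × Bool → F) := fun p => Finset.univ.filter (fun u => u p = 0)
  set S2 : (Fin n → Bool) → Finset (Fin n × Bool → F) := fun ε =>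
    Finset.univ.filter (fun u => ε ≠ (fun _ => false) ∧ (∀ p, u p ≠ 0) ∧
      ∏ i, u (i, ε i) = ∏ i, u (i, false))
  have hc : Fintype.card (Fin n × Bool) = 2 * n := by simp [mul_comm]
  have h1 : ∀ p, (S1 p).card ≤ Fintype.card F ^ (2 * n - 1) := by
    intro p
    rw [← hc]
    apply cnt_bd _ p
    intro u hu v hv _
    simp only [S1, Finset.mem_filter] at hu hv
    rw [hu.2, hv.2]
  have h2 : ∀ ε, (S2 ε).card ≤ Fintype.card F ^ (2 * n - 1) := by
    intro ε
    by_cases hε : ε = fun _ => false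
    · simp [S2, hε]
    obtain ⟨i₀, hi₀⟩ : ∃ i₀, ε i₀ ≠ false := by
      by_contra hh
      exact hε (_root_.funext fun i => by by_contra h3; exact hh ⟨i, h3⟩)
    rw [← hc]
    apply cnt_bd _ (i₀, ε i₀)
    intro u hu v hv huv
    simp only [S2, Finset.mem_filter] at hu hv
    apply prod_det u v ε i₀ (Finset.prod_ne_zero_iff.2 fun i _ => hu.2.2.1 _) _ huv
    rw [hu.2.2.2, hv.2.2.2]
    apply Finset.prod_congr rfl
    intro i _
    apply huv
    intro hh
    have := Prod.ext_iff.1 hh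
    simp only at this
    exact hi₀ this.2.symm
  calc _ ≤ ((Finset.univ.biUnion S1) ∪ (Finset.univ.biUnion S2)).card := by
        apply Finset.card_le_card
        intro u hu
        simp only [Finset.mem_filter, Finset.mem_univ, true_and] at hu
        simp only [Finset.mem_union, Finset.mem_biUnion, S1, S2, Finset.mem_filter, Finset.mem_univ, true_and]
        by_cases hz : ∃ p, u p = 0
        · exact Or.inl hz
        · push Not at hz
          right
          by_contra hh
          push Not at hh
          exact hu ⟨Finset.prod_ne_zero_iff.2 fun i _ => hz _, fun ε hε => hh ε hε hz⟩
    _ ≤ (Finset.univ.biUnion S1).card + (Finset.univ.biUnion S2).card := Finset.card_union_le _ _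
    _ ≤ (∑ p, (S1 p).card) + ∑ ε, (S2 ε).card := add_le_add Finset.card_biUnion_le Finset.card_biUnion_le
    _ ≤ (∑ p : Fin n × Bool, Fintype.card F ^ (2 * n - 1)) + ∑ ε : Fin n → Bool, Fintype.card F ^ (2 * n - 1) :=
        add_le_add (Finset.sum_le_sum fun p _ => h1 p) (Finset.sum_le_sum fun p _ => h2 p)
    _ = _ := by
        rw [Finset.sum_const, Finset.sum_const, Finset.card_univ, Finset.card_univ, hc]
        simp [add_mul]

/-- splitting off the first pair -/
def splitE (n : ℕ) (F : Type) : (Fin (n + 1) × Bool → F) ≃ (F × F) × (Fin n × Bool → F) where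
  toFun u := ((u (0, false), u (0, true)), fun p => u (p.1.succ, p.2))
  invFun w := fun p => Fin.cases (bif p.2 then w.1.2 else w.1.1) (fun i => w.2 (i, p.2)) p.1
  left_inv u := by
    funext ⟨i, b⟩
    refine Fin.cases ?_ (fun i => ?_) i
    · cases b <;> rfl
    · rfl
  right_inv w := rfl

lemma prod_split (n : ℕ) (F : Type) [Field F] (G : F → ℤ) (w : (F × F) × (Fin n × Bool → F)) :
    ∏ ε : Fin (n + 1) → Bool, G (∏ i, (splitE n F).symm w (i, ε i)) =
    (∏ ε : Fin n → Bool, G (w.1.1 * ∏ i, w.2 (i, ε i))) *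
      ∏ ε : Fin n → Bool, G (w.1.2 * ∏ i, w.2 (i, ε i)) := by
  rw [← (Fin.consEquiv (fun _ : Fin (n + 1) => Bool)).prod_comp, Fintype.prod_prod_type]
  simp only [Fintype.prod_bool]
  rw [mul_comm]
  congr 1 <;>
  · apply Finset.prod_congr rfl
    intro ε _
    rw [Fin.prod_univ_succ]
    rfl

lemma T_bd (n : ℕ) (hn : 1 ≤ n) : ∃ C : ℕ, ∀ (F : Type) [Field F] [Fintype F] [DecidableEq F]
    (_ : Odd (Fintype.card F)),
    |∑ u : Fin (n + 1) × Bool → F, ∏ ε : Fin (n + 1) → Bool,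
      quadraticChar F ((∏ i, u (i, ε i)) + 1)| ≤ (C : ℤ) * (Fintype.card F : ℤ) ^ (2 * n + 1) := by
  obtain ⟨B, hB⟩ := weil_prod (Fin n → Bool)
  refine ⟨B + (2 * n + 2 ^ n), fun F _ _ _ hodd => ?_⟩
  set q := Fintype.card F with hq
  let S : (Fin n × Bool → F) → ℤ := fun u => ∑ x, ∏ ε : Fin n → Bool, quadraticChar F (x * (∏ i, u (i, ε i)) + 1)
  have hT : ∑ u : Fin (n + 1) × Bool → F, ∏ ε : Fin (n + 1) → Bool,
      quadraticChar F ((∏ i, u (i, ε i)) + 1) = ∑ u, (S u) ^ 2 := by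
    rw [← (splitE n F).symm.sum_comp]
    rw [Finset.sum_congr rfl (fun w _ => prod_split n F (fun a => quadraticChar F (a + 1)) w)]
    rw [Fintype.sum_prod_type_right]
    apply Finset.sum_congr rfl
    intro u _
    rw [Fintype.sum_prod_type, sq]
    simp only [S]
    rw [Finset.sum_mul_sum]
  let P : (Fin n × Bool → F) → Prop := fun u => (∏ i, u (i, false) ≠ 0 ∧
      ∀ ε : Fin n → Bool, ε ≠ (fun _ => false) → ∏ i, u (i, ε i) ≠ ∏ i, u (i, false))
  have hchi : ∀ x : F, |quadraticChar F x| ≤ 1 := by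
    intro x
    by_cases hx : x = 0
    · simp [hx]
    · rcases quadraticChar_dichotomy hx with h | h <;> simp [h]
  have hpt : ∀ u, (S u) ^ 2 ≤ (B : ℤ) * q + (if ¬ P u then 1 else 0) * (q : ℤ) ^ 2 := by
    intro u
    by_cases hu : P u
    · have := hB F (fun ε => ∏ i, u (i, ε i)) (fun _ => false) hu.1 hu.2 hodd
      simpa [hu, S] using this
    · have h1 : |S u| ≤ q := by
        refine (Finset.abs_sum_le_sum_abs _ _).trans ?_
        calc _ ≤ ∑ x : F, (1 : ℤ) := by
              apply Finset.sum_le_sum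
              intro x _
              rw [Finset.abs_prod]
              exact Finset.prod_le_one (fun _ _ => abs_nonneg _) (fun _ _ => hchi _)
          _ = q := by simp [hq]
      have h2 := sq_le_sq' (abs_le.1 h1).1 (abs_le.1 h1).2
      have h3 : (0 : ℤ) ≤ B * q := by positivity
      simp only [hu, not_false_eq_true, if_true, one_mul]
      linarith
  rw [hT, abs_of_nonneg (Finset.sum_nonneg fun _ _ => sq_nonneg _)]
  refine (Finset.sum_le_sum fun u _ => hpt u).trans ?_
  rw [Finset.sum_add_distrib, ← Finset.sum_mul (Finset.univ) (fun u => if ¬ P u then (1 : ℤ) else 0)]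
  have hbad := bad_bd n F
  have hb' : (∑ u, (if ¬ P u then (1 : ℤ) else 0)) ≤ ((2 * n + 2 ^ n : ℕ) : ℤ) * (q : ℤ) ^ (2 * n - 1) := by
    rw [Finset.sum_boole]
    exact_mod_cast hbad
  have hc : Fintype.card (Fin n × Bool → F) = q ^ (2 * n) := by
    rw [Fintype.card_fun]; simp [hq, mul_comm]
  rw [Finset.sum_const, Finset.card_univ, hc]
  have h4 := mul_le_mul_of_nonneg_right hb' (sq_nonneg (q : ℤ))
  have h5 : (q : ℤ) ^ (2 * n + 1) = (q : ℤ) ^ (2 * n - 1) * (q : ℤ) ^ 2 := by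
    rw [← pow_add]; congr 1; omega
  have h6 : q ^ (2 * n) • ((B : ℤ) * q) = B * (q : ℤ) ^ (2 * n + 1) := by
    rw [pow_succ]; simp; ring
  rw [h6]
  push_cast at h4 ⊢
  rw [add_mul (B : ℤ)]
  nth_rewrite 3 [h5]
  rw [← mul_assoc]
  linarith

end Polynomial

theorem stmt_2 (k : ℕ) (hk : 2 ≤ k) :
    ∃ C : ℝ, 0 < C ∧
      ∀ (q : ℕ) (F : Type) [Field F] [Fintype F],
        Fintype.card F = q → Odd q →
          |(NEPO ((∏ i : Fin k, (MvPolynomial.X i : MvPolynomial (Fin k) F)) + 1) : ℝ) -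
              (q : ℝ) ^ (2 * k) / 2| ≤ C * (q : ℝ) ^ (2 * k - 1) := by
  classical
  obtain ⟨n, rfl⟩ : ∃ n, k = n + 1 := ⟨k - 1, by omega⟩
  obtain ⟨B, hB⟩ := Polynomial.T_bd n (by omega)
  set D : ℕ := B + 2 * (2 * (n + 1)) ^ 2 + 2 ^ (n + 1) with hD
  refine ⟨D + 1, by positivity, ?_⟩
  intro q F _ _ hq hodd
  have hT := hB F (hq ▸ hodd)
  rw [hq] at hT
  set χ := quadraticChar F
  set T := ∑ u : Fin (n + 1) × Bool → F, ∏ ε : Fin (n + 1) → Bool, χ ((∏ i, u (i, ε i)) + 1) with hTd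
  let sg : F → ℤ := fun x => if ¬ IsSquare x then -1 else 1
  let Sg : (Fin (n + 1) × Bool → F) → ℤ := fun u => ∏ ε : Fin (n + 1) → Bool, sg ((∏ i, u (i, ε i)) + 1)
  let Zr : (Fin (n + 1) × Bool → F) → Prop := fun u => ∃ ε : Fin (n + 1) → Bool, (∏ i, u (i, ε i)) + 1 = 0
  have hN : 2 * (NEPO ((∏ i : Fin (n + 1), (MvPolynomial.X i : MvPolynomial (Fin (n + 1)) F)) + 1) : ℤ)
      = ∑ u : Fin (n + 1) × Bool → F, if Function.Injective u then 1 + Sg u else 0 := by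
    have h1 : ∀ u : Fin (n + 1) × Bool → F, Set.ncard {ε : Fin (n + 1) → Bool |
        ¬ IsSquare (MvPolynomial.eval (fun i => u (i, ε i))
          ((∏ i : Fin (n + 1), (MvPolynomial.X i : MvPolynomial (Fin (n + 1)) F)) + 1))} =
        (Finset.univ.filter (fun ε : Fin (n + 1) → Bool => ¬ IsSquare ((∏ i, u (i, ε i)) + 1))).card := by
      intro u
      rw [← Set.ncard_coe_finset]
      congr 1
      ext ε
      simp [MvPolynomial.eval_prod]
    have h2 : NEPO ((∏ i : Fin (n + 1), (MvPolynomial.X i : MvPolynomial (Fin (n + 1)) F)) + 1) =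
        (Finset.univ.filter (fun u : Fin (n + 1) × Bool → F => Function.Injective u ∧
          Even (Finset.univ.filter (fun ε : Fin (n + 1) → Bool =>
            ¬ IsSquare ((∏ i, u (i, ε i)) + 1))).card)).card := by
      rw [NEPO, ← Set.ncard_coe_finset]
      congr 1
      ext u
      simp only [Set.mem_ofPred_eq, h1, Finset.coe_filter, Finset.mem_univ, true_and]
    rw [h2, Finset.card_filter, Nat.cast_sum, Finset.mul_sum]
    apply Finset.sum_congr rfl
    intro u _
    have h3 : Sg u = (-1) ^ (Finset.univ.filter (fun ε : Fin (n + 1) → Bool =>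
            ¬ IsSquare ((∏ i, u (i, ε i)) + 1))).card := by
      simp only [Sg, sg]
      rw [Finset.prod_ite]
      simp
    rw [h3]
    by_cases hi : Function.Injective u
    · rcases Nat.even_or_odd (Finset.univ.filter (fun ε : Fin (n + 1) → Bool =>
            ¬ IsSquare ((∏ i, u (i, ε i)) + 1))).card with he | ho
      · rw [if_pos ⟨hi, he⟩, if_pos hi, he.neg_one_pow]; norm_num
      · rw [if_neg (fun h => (Nat.not_even_iff_odd.2 ho) h.2), if_pos hi, ho.neg_one_pow]; norm_num
    · rw [if_neg (fun h => hi h.1), if_neg hi]; norm_num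
  have hc : Fintype.card (Fin (n + 1) × Bool) = 2 * (n + 1) := by simp [mul_comm]
  have hcu : Fintype.card (Fin (n + 1) × Bool → F) = q ^ (2 * (n + 1)) := by
    rw [Fintype.card_fun, hc, hq]
  have hpt : ∀ u : Fin (n + 1) × Bool → F,
      |(if Function.Injective u then 1 + Sg u else 0) - 1 - ∏ ε : Fin (n + 1) → Bool, χ ((∏ i, u (i, ε i)) + 1)|
      ≤ 2 * (if ¬ Function.Injective u then 1 else 0) + (if Zr u then 1 else 0) := by
    intro u
    have hchi : ∀ x : F, |χ x| ≤ 1 := by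
      intro x
      by_cases hx : x = 0
      · simp [hx, χ]
      · rcases quadraticChar_dichotomy hx with h | h <;> simp [χ, h]
    have hX : |∏ ε : Fin (n + 1) → Bool, χ ((∏ i, u (i, ε i)) + 1)| ≤ 1 := by
      rw [Finset.abs_prod]
      exact Finset.prod_le_one (fun _ _ => abs_nonneg _) (fun _ _ => hchi _)
    by_cases hi : Function.Injective u
    · by_cases hz : Zr u
      · have h0 : ∏ ε : Fin (n + 1) → Bool, χ ((∏ i, u (i, ε i)) + 1) = 0 := by
          obtain ⟨ε, hε⟩ := hz
          apply Finset.prod_eq_zero (Finset.mem_univ ε)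
          rw [hε]; simp [χ]
        have h1 : |Sg u| = 1 := by
          simp only [Sg]
          rw [Finset.abs_prod]
          apply Finset.prod_eq_one
          intro ε _
          simp only [sg]
          split_ifs <;> simp
        rw [h0, if_pos hi, if_pos hz, if_neg (not_not.2 hi)]
        simp [h1]
      · have h0 : Sg u = ∏ ε : Fin (n + 1) → Bool, χ ((∏ i, u (i, ε i)) + 1) := by
          apply Finset.prod_congr rfl
          intro ε _
          have hx : (∏ i, u (i, ε i)) + 1 ≠ 0 := fun h => hz ⟨ε, h⟩
          simp only [sg]
          split_ifs with h
          · exact ((quadraticChar_one_iff_isSquare hx).2 h).symm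
          · exact (quadraticChar_neg_one_iff_not_isSquare.2 h).symm
        rw [if_pos hi, if_neg hz, if_neg (not_not.2 hi), h0]
        simp
    · rw [if_neg hi, if_pos hi]
      have := abs_le.1 hX
      have h5 : (0 : ℤ) ≤ if Zr u then 1 else 0 := by split_ifs <;> norm_num
      rw [abs_le]
      constructor <;> linarith
  have hninj : (Finset.univ.filter (fun u : Fin (n + 1) × Bool → F => ¬ Function.Injective u)).card
      ≤ (2 * (n + 1)) ^ 2 * q ^ (2 * (n + 1) - 1) := by
    let S : ((Fin (n + 1) × Bool) × (Fin (n + 1) × Bool)) → Finset (Fin (n + 1) × Bool → F) :=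
      fun p => Finset.univ.filter (fun u => p.1 ≠ p.2 ∧ u p.1 = u p.2)
    calc _ ≤ (Finset.univ.biUnion S).card := by
          apply Finset.card_le_card
          intro u hu
          simp only [Finset.mem_filter, Finset.mem_univ, true_and, Function.Injective, not_forall] at hu
          obtain ⟨a, b, h1, h2⟩ := hu
          simp only [Finset.mem_biUnion, S, Finset.mem_filter, Finset.mem_univ, true_and]
          exact ⟨(a, b), h2, h1⟩
      _ ≤ ∑ p, (S p).card := Finset.card_biUnion_le
      _ ≤ ∑ p : (Fin (n + 1) × Bool) × (Fin (n + 1) × Bool), q ^ (2 * (n + 1) - 1) := by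
          apply Finset.sum_le_sum
          intro p _
          rw [← hc, ← hq]
          apply Polynomial.cnt_bd _ p.1
          intro u hu v hv huv
          simp only [S, Finset.mem_filter] at hu hv
          rw [hu.2.2, hv.2.2]
          exact huv _ hu.2.1.symm
      _ = _ := by
          rw [Finset.sum_const, Finset.card_univ, Fintype.card_prod, hc, smul_eq_mul, sq]
  have hzr : (Finset.univ.filter Zr).card ≤ 2 ^ (n + 1) * q ^ (2 * (n + 1) - 1) := by
    let S : (Fin (n + 1) → Bool) → Finset (Fin (n + 1) × Bool → F) :=
      fun ε => Finset.univ.filter (fun u => (∏ i, u (i, ε i)) + 1 = 0)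
    calc _ ≤ (Finset.univ.biUnion S).card := by
          apply Finset.card_le_card
          intro u hu
          simp only [Finset.mem_filter, Finset.mem_univ, true_and, Zr] at hu
          simp only [Finset.mem_biUnion, S, Finset.mem_filter, Finset.mem_univ, true_and]
          exact hu
      _ ≤ ∑ p, (S p).card := Finset.card_biUnion_le
      _ ≤ ∑ p : Fin (n + 1) → Bool, q ^ (2 * (n + 1) - 1) := by
          apply Finset.sum_le_sum
          intro ε _
          rw [← hc, ← hq]
          apply Polynomial.cnt_bd _ (0, ε 0)
          intro u hu v hv huv
          simp only [S, Finset.mem_filter] at hu hv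
          have e1 := eq_neg_of_add_eq_zero_left hu.2
          have e2 := eq_neg_of_add_eq_zero_left hv.2
          apply Polynomial.prod_det u v ε 0 _ (e1.trans e2.symm) huv
          rw [e1]; simp
      _ = _ := by
          rw [Finset.sum_const, Finset.card_univ, smul_eq_mul]; simp
  set N := NEPO ((∏ i : Fin (n + 1), (MvPolynomial.X i : MvPolynomial (Fin (n + 1)) F)) + 1)
  have hmain : |2 * (N : ℤ) - (q : ℤ) ^ (2 * (n + 1)) - T| ≤
      2 * ((2 * (n + 1)) ^ 2 * q ^ (2 * (n + 1) - 1)) + 2 ^ (n + 1) * q ^ (2 * (n + 1) - 1) := by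
    have e : 2 * (N : ℤ) - (q : ℤ) ^ (2 * (n + 1)) - T = ∑ u : Fin (n + 1) × Bool → F,
        ((if Function.Injective u then 1 + Sg u else 0) - 1 -
          ∏ ε : Fin (n + 1) → Bool, χ ((∏ i, u (i, ε i)) + 1)) := by
      rw [Finset.sum_sub_distrib, Finset.sum_sub_distrib, ← hN, ← hTd, Finset.sum_const,
        Finset.card_univ, hcu]
      simp
    rw [e]
    refine (Finset.abs_sum_le_sum_abs _ _).trans ((Finset.sum_le_sum fun u _ => hpt u).trans ?_)
    rw [Finset.sum_add_distrib, ← Finset.mul_sum, Finset.sum_boole, Finset.sum_boole]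
    have a1 : ((Finset.univ.filter (fun u : Fin (n + 1) × Bool → F => ¬ Function.Injective u)).card : ℤ)
      ≤ (2 * (n + 1)) ^ 2 * q ^ (2 * (n + 1) - 1) := by exact_mod_cast hninj
    have a2 : ((Finset.univ.filter Zr).card : ℤ) ≤ 2 ^ (n + 1) * q ^ (2 * (n + 1) - 1) := by
      exact_mod_cast hzr
    linarith
  rw [show 2 * n + 1 = 2 * (n + 1) - 1 by omega] at hT
  have hfin : |2 * (N : ℤ) - (q : ℤ) ^ (2 * (n + 1))| ≤ (D : ℤ) * q ^ (2 * (n + 1) - 1) := by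
    have e : 2 * (N : ℤ) - (q : ℤ) ^ (2 * (n + 1)) = (2 * (N : ℤ) - (q : ℤ) ^ (2 * (n + 1)) - T) + T := by ring
    rw [e]
    refine (abs_add_le _ _).trans ((add_le_add hmain hT).trans (le_of_eq ?_))
    rw [hD]; push_cast; ring
  have hfinR : |2 * (N : ℝ) - (q : ℝ) ^ (2 * (n + 1))| ≤ (D : ℝ) * q ^ (2 * (n + 1) - 1) := by
    exact_mod_cast hfin
  have e : (N : ℝ) - (q : ℝ) ^ (2 * (n + 1)) / 2 = (2 * (N : ℝ) - (q : ℝ) ^ (2 * (n + 1))) / 2 := by ring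
  have hp : (0 : ℝ) ≤ (q : ℝ) ^ (2 * (n + 1) - 1) := by positivity
  have hp2 : (0 : ℝ) ≤ (D : ℝ) * (q : ℝ) ^ (2 * (n + 1) - 1) := by positivity
  rw [e, abs_div, abs_two, add_mul]
  linarith
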